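/- Let u, v ∈ E⁺ be words such that ū = v̄ in IG(E), and let u = p₁⋯pₘ and v = q₁⋯q_s be any minimal r-factorisations. Then m = s, p̄ᵢ 𝓓 q̄ᵢ in IG(E) for all 1 ≤ i ≤ m, and furthermore p̄₁ 𝓡 q̄₁ and p̄ₘ 𝓛 q̄ₘ. -/

import Mathlib

section Green

variable {T : Type*} [Semigroup T]

/-- Green's relation 𝓡. -/
def GreenR (a b : T) : Prop := a = b ∨ ∃ x y : T, a * x = b ∧ b * y = a

/-- Green's relation 𝓛. -/
def GreenL (a b : T) : Prop := a = b ∨ ∃ x y : T, x * a = b ∧ y * b = a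

/-- Green's relation 𝓓 = 𝓡 ∘ 𝓛. -/
def GreenD (a b : T) : Prop := ∃ c : T, GreenR a c ∧ GreenL c b

/-- An element is regular if `a = a * b * a` for some `b`. -/
def IsRegularElem (a : T) : Prop := ∃ b : T, a * b * a = a

/-- The principal two-sided ideal `T¹ a T¹`. -/
def principalIdeal (a : T) : Set T :=
  {x | x = a ∨ (∃ u, u * a = x) ∨ (∃ v, a * v = x) ∨ ∃ u v, u * a * v = x}

/-- Green's relation 𝓙. -/
def GreenJ (a b : T) : Prop := principalIdeal a = principalIdeal b

/-- The 𝓙-preorder. -/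
def JleRel (a b : T) : Prop := principalIdeal a ⊆ principalIdeal b

/-- Strict 𝓙-order. -/
def JltRel (a b : T) : Prop := JleRel a b ∧ ¬ JleRel b a

/-- `u` is a (two-sided) identity element. -/
def IsIdentityElem (u : T) : Prop := ∀ x : T, u * x = x ∧ x * u = x

/-- The relation 𝓡̃. -/
def RTilde (a b : T) : Prop := ∀ ε : T, ε * ε = ε → (ε * a = a ↔ ε * b = b)

/-- The relation 𝓛̃. -/
def LTilde (a b : T) : Prop := ∀ ε : T, ε * ε = ε → (a * ε = a ↔ b * ε = b)

/-- `blockProd p i k = p i * p (i+1) * ⋯ * p (i+k)`. -/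
def blockProd (p : ℕ → T) (i : ℕ) : ℕ → T
  | 0 => p i
  | k + 1 => blockProd p i k * p (i + (k + 1))

/-- Multiply `x` by optional (possibly empty) words on both sides. -/
def withCtx (u : Option T) (x : T) (v : Option T) : T :=
  match u, v with
  | none, none => x
  | some u', none => u' * x
  | none, some v' => x * v'
  | some u', some v' => u' * x * v'

/-- Multiply by an optional word on the left. -/
def leftCtx (u : Option T) (x : T) : T := match u with | none => x | some u' => u' * x

/-- Multiply by an optional word on the right. -/
def rightCtx (x : T) (v : Option T) : T := match v with | none => x | some v' => x * v'

end Green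

section IGdef

/-- The set of idempotents of `S`. -/
abbrev IdemE (S : Type*) [Semigroup S] : Type _ := {x : S // x * x = x}

variable {S : Type*} [Semigroup S]

/-- `e, f` form a basic pair if `{e,f} ∩ {ef,fe} ≠ ∅`. -/
def BasicPair (e f : IdemE S) : Prop :=
  (e : S) * f = e ∨ (e : S) * f = f ∨ (f : S) * e = e ∨ (f : S) * e = f

/-- The defining relations of IG(E): `ef = g` whenever `e, f` is a basic pair with
product `g` in `S`. -/
def igRelBase (u v : FreeSemigroup (IdemE S)) : Prop :=
  ∃ e f g : IdemE S, BasicPair e f ∧ (g : S) = (e : S) * (f : S) ∧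
    u = FreeSemigroup.of e * FreeSemigroup.of f ∧ v = FreeSemigroup.of g

/-- The congruence on the free semigroup `E⁺` generated by the defining relations. -/
def igCon (S : Type*) [Semigroup S] : Con (FreeSemigroup (IdemE S)) :=
  conGen (fun u v => igRelBase u v)

/-- The free idempotent generated semigroup IG(E). -/
abbrev IG (S : Type*) [Semigroup S] := (igCon S).Quotient

/-- `w̄`, the image of a word `w ∈ E⁺` in IG(E). -/
def igBar (w : FreeSemigroup (IdemE S)) : IG S := (w : (igCon S).Quotient)

/-- The list of letters of a word. -/
def wordList (w : FreeSemigroup (IdemE S)) : List (IdemE S) := w.head :: w.tail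

/-- The length of a word. -/
def wlen (w : FreeSemigroup (IdemE S)) : ℕ := (wordList w).length

/-- Length of an optional word. -/
def olen (u : Option (FreeSemigroup (IdemE S))) : ℕ :=
  match u with | none => 0 | some u' => wlen u'

/-- `p 1, …, p m` is an r-factorisation of `w`: each factor represents a regular
element of IG(E). -/
def IsRFact (w : FreeSemigroup (IdemE S)) (m : ℕ) (p : ℕ → FreeSemigroup (IdemE S)) : Prop :=
  1 ≤ m ∧ blockProd p 1 (m - 1) = w ∧ ∀ i, 1 ≤ i → i ≤ m → IsRegularElem (igBar (p i))

/-- A minimal r-factorisation: no product of two or more consecutive factors is regular. -/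
def IsMinRFact (w : FreeSemigroup (IdemE S)) (m : ℕ) (p : ℕ → FreeSemigroup (IdemE S)) : Prop :=
  IsRFact w m p ∧
    ∀ i j, 1 ≤ i → i < j → j ≤ m → ¬ IsRegularElem (igBar (blockProd p i (j - i)))

/-- The relation ≈ on m-tuples of words. -/
def TupleApprox (m : ℕ) (p q : ℕ → FreeSemigroup (IdemE S)) : Prop :=
  (∃ i, 1 ≤ i ∧ i ≤ m ∧ igBar (p i) = igBar (q i) ∧
    ∀ j, 1 ≤ j → j ≤ m → j ≠ i → p j = q j) ∨
  (∃ i, ∃ e : IdemE S, 1 ≤ i ∧ i < m ∧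
    igBar (p i) = igBar (q i * FreeSemigroup.of e) ∧
    igBar (q (i + 1)) = igBar (FreeSemigroup.of e * p (i + 1)) ∧
    ∀ j, 1 ≤ j → j ≤ m → j ≠ i → j ≠ i + 1 → p j = q j) ∨
  (∃ i, ∃ e : IdemE S, 1 ≤ i ∧ i < m ∧
    igBar (q i) = igBar (p i * FreeSemigroup.of e) ∧
    igBar (p (i + 1)) = igBar (FreeSemigroup.of e * q (i + 1)) ∧
    ∀ j, 1 ≤ j → j ≤ m → j ≠ i → j ≠ i + 1 → p j = q j)

/-- The relation ∼: the transitive closure of ≈. -/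
def TupleSim (m : ℕ) (p q : ℕ → FreeSemigroup (IdemE S)) : Prop :=
  Relation.TransGen (TupleApprox m) p q

/-- One application of a defining relation of IG(E) inside a word. -/
def RewriteStep (w w' : FreeSemigroup (IdemE S)) : Prop :=
  ∃ (u v : Option (FreeSemigroup (IdemE S))) (x y : FreeSemigroup (IdemE S)),
    (igRelBase x y ∨ igRelBase y x) ∧ w = withCtx u x v ∧ w' = withCtx u y v

/-- `e` is a seed of `w` at (1-based) position `k`. -/
def SeedAt (w : FreeSemigroup (IdemE S)) (e : IdemE S) (k : ℕ) : Prop :=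
  ∃ u v : Option (FreeSemigroup (IdemE S)),
    w = withCtx u (FreeSemigroup.of e) v ∧ k = olen u + 1 ∧
    GreenL (igBar (leftCtx u (FreeSemigroup.of e))) (igBar (FreeSemigroup.of e)) ∧
    GreenR (igBar (FreeSemigroup.of e)) (igBar (rightCtx (FreeSemigroup.of e) v))

/-- The coordinate (position within `w` of the first letter) of the `i`-th factor. -/
def wcoord (p : ℕ → FreeSemigroup (IdemE S)) (i : ℕ) : ℕ :=
  1 + ∑ j ∈ Finset.Ico 1 i, wlen (p j)

end IGdef

section MonoidGreen

variable {M : Type*} [Monoid M]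

/-- Green's relation 𝓡 in a monoid. -/
def MonR (a b : M) : Prop := (∃ x, a * x = b) ∧ ∃ y, b * y = a

/-- Green's relation 𝓛 in a monoid. -/
def MonL (a b : M) : Prop := (∃ x, x * a = b) ∧ ∃ y, y * b = a

/-- Green's relation 𝓓 in a monoid. -/
def MonD (a b : M) : Prop := ∃ c, MonR a c ∧ MonL c b

theorem MonR.symm {a b : M} (h : MonR a b) : MonR b a := ⟨h.2, h.1⟩

theorem MonL.symm {a b : M} (h : MonL a b) : MonL b a := ⟨h.2, h.1⟩

theorem MonR.trans {a b c : M} (h : MonR a b) (h' : MonR b c) : MonR a c := by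
  obtain ⟨⟨x, rfl⟩, y, hy⟩ := h
  obtain ⟨⟨x', rfl⟩, y', hy'⟩ := h'
  exact ⟨⟨x * x', by rw [mul_assoc]⟩, y' * y, by rw [← mul_assoc, hy', hy]⟩

theorem MonL.trans {a b c : M} (h : MonL a b) (h' : MonL b c) : MonL a c := by
  obtain ⟨⟨x, rfl⟩, y, hy⟩ := h
  obtain ⟨⟨x', rfl⟩, y', hy'⟩ := h'
  exact ⟨⟨x' * x, by rw [mul_assoc]⟩, y * y', by rw [mul_assoc, hy', hy]⟩

theorem monD_of_monL_monR {a b c : M} (h : MonL a c) (h' : MonR c b) : MonD a b := by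
  obtain ⟨⟨x, hx⟩, y, hy⟩ := h
  obtain ⟨⟨z, hz⟩, z', hz'⟩ := h'
  refine ⟨a * z, ⟨⟨z, rfl⟩, z', ?_⟩, ⟨x, ?_⟩, y, ?_⟩
  · rw [← hy, mul_assoc y, hz, mul_assoc, hz']
  · rw [← mul_assoc, hx, hz]
  · rw [← hy, mul_assoc, hz]

theorem MonD.symm {a b : M} (h : MonD a b) : MonD b a :=
  let ⟨_, h₁, h₂⟩ := h
  monD_of_monL_monR h₂.symm h₁.symm

theorem MonD.trans {a b c : M} (h : MonD a b) (h' : MonD b c) : MonD a c := by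
  obtain ⟨x, h₁, h₂⟩ := h
  obtain ⟨y, h₃, h₄⟩ := h'
  obtain ⟨z, h₅, h₆⟩ := monD_of_monL_monR h₂ h₃
  exact ⟨z, h₁.trans h₅, h₆.trans h₄⟩

/-- `P a b` behaves like the value of the segment `[a, b)` of a word. -/
def IsSegment (P : ℕ → ℕ → M) : Prop :=
  ∀ a b c, a ≤ b → b ≤ c → P a b * P b c = P a c

/-- The segment `[a, k]` is 𝓛-related to the letter at position `k`. -/
def LeftSeed (P : ℕ → ℕ → M) (a k : ℕ) : Prop :=
  a ≤ k ∧ ∃ y, y * P a (k + 1) = P k (k + 1)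

/-- The segment `[k, b)` is 𝓡-related to the letter at position `k`. -/
def RightSeed (P : ℕ → ℕ → M) (k b : ℕ) : Prop :=
  k < b ∧ ∃ z, P k b * z = P k (k + 1)

/-- Position `k` carries a seed of the segment `[a, b)`. -/
def IsSeedPos (P : ℕ → ℕ → M) (a k b : ℕ) : Prop := LeftSeed P a k ∧ RightSeed P k b

variable {P : ℕ → ℕ → M}

theorem LeftSeed.mono (hP : IsSegment P) {a a' k : ℕ} (h : LeftSeed P a k) (h₁ : a ≤ a')
    (h₂ : a' ≤ k) : LeftSeed P a' k := by
  obtain ⟨_, y, hy⟩ := h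
  refine ⟨h₂, y * P a a', ?_⟩
  rw [mul_assoc, hP _ _ _ h₁ (by omega), hy]

theorem RightSeed.mono (hP : IsSegment P) {k b b' : ℕ} (h : RightSeed P k b) (h₁ : b' ≤ b)
    (h₂ : k < b') : RightSeed P k b' := by
  obtain ⟨_, z, hz⟩ := h
  refine ⟨h₂, P b' b * z, ?_⟩
  rw [← mul_assoc, hP _ _ _ h₂.le h₁, hz]

theorem RightSeed.extend (hP : IsSegment P) {k k' b d : ℕ} (h : RightSeed P k b) (h₁ : k ≤ k')
    (h₂ : k' < b) (h' : RightSeed P k' d) : RightSeed P k d := by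
  obtain ⟨_, z, hz⟩ := h
  obtain ⟨h₃, z', hz'⟩ := h'
  refine ⟨by omega, z' * P (k' + 1) b * z, ?_⟩
  rw [← hP k k' d h₁ h₃.le, mul_assoc, ← mul_assoc (P k' d), ← mul_assoc (P k' d), hz',
    hP _ _ _ (by omega) (by omega), ← mul_assoc, hP _ _ _ h₁ h₂.le, hz]

theorem LeftSeed.extend (hP : IsSegment P) {a c k k' : ℕ} (h : LeftSeed P c k') (h₁ : c ≤ k)
    (h₂ : k ≤ k') (h' : LeftSeed P a k) : LeftSeed P a k' := by
  obtain ⟨_, y, hy⟩ := h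
  obtain ⟨h₃, y', hy'⟩ := h'
  refine ⟨by omega, y * P c k * y', ?_⟩
  rw [← hP a (k + 1) (k' + 1) (by omega) (by omega), mul_assoc, ← mul_assoc y', hy',
    mul_assoc y, ← mul_assoc (P c k), hP _ _ _ h₁ (by omega), hP _ _ _ (by omega) (by omega), hy]

theorem RightSeed.of_leftSeed (hP : IsSegment P) {c d k k' : ℕ} (h : LeftSeed P c k) (h₁ : c ≤ k')
    (h₂ : k' ≤ k) (h₃ : k < d) (h' : RightSeed P k' d) : RightSeed P k d := by
  obtain ⟨_, y, hy⟩ := h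
  obtain ⟨_, z, hz⟩ := h'
  refine ⟨h₃, z * P (k' + 1) (k + 1), ?_⟩
  rw [← hP k (k + 1) d (by omega) h₃, ← hy, mul_assoc y, hP _ _ _ (by omega) h₃,
    ← hP c k' d h₁ (by omega), ← mul_assoc, mul_assoc y, mul_assoc (P c k'), hz,
    hP _ _ _ h₁ (by omega), mul_assoc, hP _ _ _ (by omega) (by omega)]

theorem LeftSeed.of_rightSeed (hP : IsSegment P) {c d k k' : ℕ} (h : RightSeed P k d) (h₁ : c ≤ k)
    (h₂ : k ≤ k') (h₃ : k' < d) (h' : LeftSeed P c k') : LeftSeed P c k := by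
  obtain ⟨_, z, hz⟩ := h
  obtain ⟨_, y, hy⟩ := h'
  refine ⟨h₁, P k k' * y, ?_⟩
  rw [← hP c k (k + 1) h₁ (by omega), ← hz, ← mul_assoc, ← mul_assoc, mul_assoc (P k k' * y),
    hP _ _ _ h₁ (by omega), ← hP c (k' + 1) d (by omega) (by omega), ← mul_assoc,
    mul_assoc (P k k'), hy, hP _ _ _ h₂ (by omega), hP _ _ _ (by omega) (by omega)]

theorem IsSeedPos.mono (hP : IsSegment P) {a a' k b b' : ℕ} (h : IsSeedPos P a k b) (h₁ : a ≤ a')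
    (h₂ : a' ≤ k) (h₃ : k < b') (h₄ : b' ≤ b) : IsSeedPos P a' k b' :=
  ⟨h.1.mono hP h₁ h₂, h.2.mono hP h₄ h₃⟩

theorem IsSeedPos.exists_extend_left (hP : IsSegment P) {a b k l x : ℕ} (h : IsSeedPos P a k b)
    (hl : LeftSeed P x l) (hxa : x ≤ a) (hal : a ≤ l) (hlb : l < b) :
    ∃ k', IsSeedPos P x k' b := by
  have hak := h.1.1
  rcases le_total k l with hkl | hlk
  · exact ⟨l, hl, RightSeed.of_leftSeed hP hl (by omega) hkl hlb h.2⟩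
  · exact ⟨k, h.1.extend hP hal hlk hl, h.2⟩

theorem IsSeedPos.exists_extend_right (hP : IsSegment P) {a b k l y : ℕ} (h : IsSeedPos P a k b)
    (hl : RightSeed P l y) (hby : b ≤ y) (hal : a ≤ l) (hlb : l < b) :
    ∃ k', IsSeedPos P a k' y := by
  have hkb := h.2.1
  rcases le_total k l with hkl | hlk
  · exact ⟨k, h.1, h.2.extend hP hkl hlb hl⟩
  · exact ⟨l, LeftSeed.of_rightSeed hP hl hal hlk (by omega) h.1, hl⟩

theorem IsSeedPos.monR (hP : IsSegment P) {a k b : ℕ} (h : IsSeedPos P a k b) :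
    MonR (P a b) (P a (k + 1)) := by
  obtain ⟨⟨h₁, _⟩, h₂, z, hz⟩ := h
  refine ⟨⟨z, ?_⟩, P (k + 1) b, hP _ _ _ (by omega) (by omega)⟩
  rw [← hP a k b h₁ h₂.le, mul_assoc, hz, hP _ _ _ h₁ (by omega)]

theorem IsSeedPos.monL (hP : IsSegment P) {a k b : ℕ} (h : IsSeedPos P a k b) :
    MonL (P a b) (P k b) := by
  obtain ⟨⟨h₁, y, hy⟩, h₂, _⟩ := h
  refine ⟨⟨y, ?_⟩, P a k, hP _ _ _ (by omega) (by omega)⟩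
  rw [← hP a (k + 1) b (by omega) h₂, ← mul_assoc, hy, hP _ _ _ (by omega) h₂]

theorem IsSeedPos.monD (hP : IsSegment P) {a k b : ℕ} (h : IsSeedPos P a k b) :
    MonD (P a b) (P k (k + 1)) := by
  refine ⟨_, h.monR hP, ?_⟩
  obtain ⟨⟨h₁, y, hy⟩, h₂, _⟩ := h
  exact ⟨⟨y, hy⟩, P a k, hP _ _ _ h₁ (by omega)⟩

/-- The cuts `0 = a 0 < a 1 < ⋯ < a m = n` divide `[0, n)` into segments with seeds. -/
structure IsSeedCut (P : ℕ → ℕ → M) (n m : ℕ) (a : ℕ → ℕ) : Prop where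
  zero : a 0 = 0
  last : a m = n
  seed : ∀ i < m, ∃ k, IsSeedPos P (a i) k (a (i + 1))

/-- A division into segments with seeds, no two or more consecutive of which can be merged. -/
structure IsMinSeedCut (P : ℕ → ℕ → M) (n m : ℕ) (a : ℕ → ℕ) : Prop
    extends IsSeedCut P n m a where
  minimal : ∀ i j, i + 1 < j → j ≤ m → ¬ ∃ k, IsSeedPos P (a i) k (a j)

theorem IsSeedCut.mono {n m : ℕ} {a : ℕ → ℕ} (h : IsSeedCut P n m a) {i j : ℕ} (hij : i ≤ j)
    (hj : j ≤ m) : a i ≤ a j := by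
  induction j, hij using Nat.le_induction with
  | base => exact le_rfl
  | succ j hij ih =>
    obtain ⟨k, hk⟩ := h.seed j hj
    have := hk.1.1
    have := hk.2.1
    have := ih (by omega)
    omega

theorem IsSeedCut.exists_mem {n m : ℕ} {a : ℕ → ℕ} (h : IsSeedCut P n m a) {l : ℕ} (hl : l < n) :
    ∃ i < m, a i ≤ l ∧ l < a (i + 1) := by
  classical
  have hex : ∃ i, l < a i := ⟨m, by rw [h.last]; exact hl⟩
  have h0 : Nat.find hex ≠ 0 := by
    intro h0
    have := Nat.find_spec hex
    rw [h0, h.zero] at this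
    omega
  obtain ⟨i, hi⟩ := Nat.exists_eq_succ_of_ne_zero h0
  have hm : Nat.find hex ≤ m := Nat.find_min' hex (by rw [h.last]; exact hl)
  refine ⟨i, by omega, ?_, ?_⟩
  · exact not_lt.1 (Nat.find_min hex (by omega : i < Nat.find hex))
  · have := Nat.find_spec hex
    rwa [hi] at this

theorem IsMinSeedCut.lt_of_leftSeed (hP : IsSegment P) {n m : ℕ} {a : ℕ → ℕ}
    (h : IsMinSeedCut P n m a) {i l : ℕ}
    (him : i < m) (hl : LeftSeed P (a i) l) (hln : l < n) : l < a (i + 1) := by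
  by_contra hcon
  obtain ⟨j, hjm, hj₁, hj₂⟩ := h.exists_mem hln
  have hij : i < j := by
    by_contra hji
    have := h.mono (i := j + 1) (j := i + 1) (by omega) him
    omega
  obtain ⟨k, hk⟩ := h.seed j hjm
  exact h.minimal i (j + 1) (by omega) hjm
    (hk.exists_extend_left hP hl (h.mono hij.le hjm.le) hj₁ hj₂)

theorem IsMinSeedCut.le_of_rightSeed (hP : IsSegment P) {n m : ℕ} {a : ℕ → ℕ}
    (h : IsMinSeedCut P n m a) {i l : ℕ}
    (him : i < m) (hl : RightSeed P l (a (i + 1))) : a i ≤ l := by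
  by_contra hcon
  have hln : l < n := by
    have := h.mono him.le le_rfl
    have := h.last
    omega
  obtain ⟨j, hjm, hj₁, hj₂⟩ := h.exists_mem hln
  have hij : j < i := by
    by_contra hji
    have := h.mono (i := i) (j := j) (by omega) hjm.le
    omega
  obtain ⟨k, hk⟩ := h.seed j hjm
  exact h.minimal j (i + 1) (by omega) him
    (hk.exists_extend_right hP hl (h.mono (by omega) him) hj₁ hj₂)

theorem IsMinSeedCut.le_and_seed_lt (hP : IsSegment P) {n m s : ℕ} {a b : ℕ → ℕ}
    (ha : IsMinSeedCut P n m a) {i k k' : ℕ} (him : i < m) (his : i < s) (hb : IsMinSeedCut P n s b)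
    (hk : IsSeedPos P (a i) k (a (i + 1))) (hk' : IsSeedPos P (b i) k' (b (i + 1)))
    (h : b i ≤ k) : k' < a (i + 1) := by
  rcases lt_or_ge k' k with hlt | hle
  · exact hlt.trans hk.2.1
  · refine ha.lt_of_leftSeed hP him (hk'.1.extend hP h hle hk.1) ?_
    have : b (i + 1) ≤ b s := hb.mono his le_rfl
    have := hb.last
    have := hk'.2.1
    omega

theorem IsMinSeedCut.pos {n m : ℕ} {a : ℕ → ℕ} (h : IsMinSeedCut P n m a) (hn : 0 < n) :
    0 < m := by
  rcases Nat.eq_zero_or_pos m with rfl | hm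
  · have := h.zero
    have := h.last
    omega
  · exact hm

/-- Seeds of the `i`-th segments of two minimal divisions lie in both segments. -/
def SeedsMutual (a b : ℕ → ℕ) (i k k' : ℕ) : Prop :=
  (b i ≤ k ∧ k < b (i + 1)) ∧ a i ≤ k' ∧ k' < a (i + 1)

theorem SeedsMutual.symm {a b : ℕ → ℕ} {i k k' : ℕ} (h : SeedsMutual a b i k k') :
    SeedsMutual b a i k' k := ⟨h.2, h.1⟩

theorem SeedsMutual.isSeedPos (hP : IsSegment P) {a b : ℕ → ℕ} {i k k' : ℕ}
    (h : SeedsMutual a b i k k')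
    (hk : IsSeedPos P (a i) k (a (i + 1))) (hk' : IsSeedPos P (b i) k' (b (i + 1))) :
    IsSeedPos P (b i) k (b (i + 1)) := by
  obtain ⟨⟨h₁, h₂⟩, h₃, h₄⟩ := h
  rcases le_total k k' with hle | hle
  · exact ⟨LeftSeed.of_rightSeed hP hk.2 h₁ hle h₄ hk'.1, hk.2.extend hP hle h₄ hk'.2⟩
  · exact ⟨hk.1.extend hP h₃ hle hk'.1, RightSeed.of_leftSeed hP hk.1 h₃ hle h₂ hk'.2⟩

theorem SeedsMutual.le_next (hP : IsSegment P) {n m : ℕ} {a b : ℕ → ℕ} {i k k' l : ℕ}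
    (h : SeedsMutual a b i k k') (ha : IsMinSeedCut P n m a) (him : i + 1 < m)
    (hk : IsSeedPos P (a i) k (a (i + 1))) (hk' : IsSeedPos P (b i) k' (b (i + 1)))
    (hl : IsSeedPos P (a (i + 1)) l (a (i + 1 + 1))) : b (i + 1) ≤ l := by
  by_contra hcon
  have hkl : k < l := hk.2.1.trans_le hl.1.1
  have := ha.le_of_rightSeed hP him
    ((h.isSeedPos hP hk hk').2.extend hP hkl.le (not_le.1 hcon) hl.2)
  have := hk.2.1
  omega

theorem IsMinSeedCut.seedsMutual (hP : IsSegment P) {n m s : ℕ} {a b : ℕ → ℕ}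
    (ha : IsMinSeedCut P n m a)
    (hb : IsMinSeedCut P n s b) {i : ℕ} (him : i < m) (his : i < s) {k k' : ℕ}
    (hk : IsSeedPos P (a i) k (a (i + 1))) (hk' : IsSeedPos P (b i) k' (b (i + 1))) :
    SeedsMutual a b i k k' := by
  induction i generalizing k k' with
  | zero =>
    have h₁ : b 0 ≤ k := by rw [hb.zero]; omega
    have h₂ : a 0 ≤ k' := by rw [ha.zero]; omega
    exact ⟨⟨h₁, hb.le_and_seed_lt hP his him ha hk' hk h₂⟩,
      h₂, ha.le_and_seed_lt hP him his hb hk hk' h₁⟩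
  | succ i ih =>
    obtain ⟨l, hl⟩ := ha.seed i (by omega)
    obtain ⟨l', hl'⟩ := hb.seed i (by omega)
    have h := ih (by omega) (by omega) hl hl'
    have h₁ := h.le_next hP ha him hl hl' hk
    have h₂ := h.symm.le_next hP hb his hl' hl hk'
    exact ⟨⟨h₁, hb.le_and_seed_lt hP his him ha hk' hk h₂⟩,
      h₂, ha.le_and_seed_lt hP him his hb hk hk' h₁⟩

theorem IsMinSeedCut.length_le (hP : IsSegment P) {n m s : ℕ} {a b : ℕ → ℕ}
    (ha : IsMinSeedCut P n m a) (hb : IsMinSeedCut P n s b) (hn : 0 < n) : m ≤ s := by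
  by_contra! hcon
  obtain ⟨t, rfl⟩ := Nat.exists_eq_succ_of_ne_zero (hb.pos hn).ne'
  obtain ⟨k, hk⟩ := ha.seed t (by omega)
  obtain ⟨k', hk'⟩ := hb.seed t (by omega)
  obtain ⟨l, hl⟩ := ha.seed (t + 1) (by omega)
  have h₁ := (ha.seedsMutual hP hb (by omega) (by omega) hk hk').le_next hP ha (by omega) hk hk' hl
  have h₂ := ha.mono (i := t + 1 + 1) (j := m) (by omega) le_rfl
  rw [ha.last] at h₂
  have h₃ := hb.last
  have h₄ := hl.2.1
  simp only [Nat.succ_eq_add_one] at h₃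
  omega

/-- Two sequences of elements, of lengths `m` and `s`, that have the same length, are entrywise
𝓓-related, have 𝓡-related first terms and 𝓛-related last terms. -/
def GreenSimilar (m s : ℕ) (f g : ℕ → M) : Prop :=
  m = s ∧ (∀ i < m, MonD (f i) (g i)) ∧ MonR (f 0) (g 0) ∧ MonL (f (m - 1)) (g (m - 1))

theorem GreenSimilar.symm {m s : ℕ} {f g : ℕ → M} (h : GreenSimilar m s f g) :
    GreenSimilar s m g f := by
  obtain ⟨rfl, h₁, h₂, h₃⟩ := h
  exact ⟨rfl, fun i hi => (h₁ i hi).symm, h₂.symm, h₃.symm⟩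

theorem GreenSimilar.trans {m s t : ℕ} {f g h : ℕ → M} (hfg : GreenSimilar m s f g)
    (hgh : GreenSimilar s t g h) : GreenSimilar m t f h := by
  obtain ⟨rfl, h₁, h₂, h₃⟩ := hfg
  obtain ⟨rfl, h₄, h₅, h₆⟩ := hgh
  exact ⟨rfl, fun i hi => (h₁ i hi).trans (h₄ i hi), h₂.trans h₅, h₃.trans h₆⟩

theorem IsMinSeedCut.greenSimilar (hP : IsSegment P) {n m s : ℕ} {a b : ℕ → ℕ}
    (ha : IsMinSeedCut P n m a) (hb : IsMinSeedCut P n s b) (hn : 0 < n) :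
    GreenSimilar m s (fun i => P (a i) (a (i + 1))) (fun i => P (b i) (b (i + 1))) := by
  obtain rfl : m = s := le_antisymm (ha.length_le hP hb hn) (hb.length_le hP ha hn)
  have key : ∀ i < m, ∃ k, IsSeedPos P (a i) k (a (i + 1)) ∧ IsSeedPos P (b i) k (b (i + 1)) := by
    intro i hi
    obtain ⟨k, hk⟩ := ha.seed i hi
    obtain ⟨k', hk'⟩ := hb.seed i hi
    exact ⟨k, hk, (ha.seedsMutual hP hb hi hi hk hk').isSeedPos hP hk hk'⟩
  have hm := ha.pos hn
  refine ⟨rfl, fun i hi => ?_, ?_, ?_⟩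
  · obtain ⟨k, h₁, h₂⟩ := key i hi
    exact (h₁.monD hP).trans (h₂.monD hP).symm
  · obtain ⟨k, h₁, h₂⟩ := key 0 hm
    have h₁ := h₁.monR hP
    have h₂ := h₂.monR hP
    rw [ha.zero] at h₁
    rw [hb.zero] at h₂
    simpa only [ha.zero, hb.zero] using h₁.trans h₂.symm
  · obtain ⟨k, h₁, h₂⟩ := key (m - 1) (by omega)
    have h₁ := h₁.monL hP
    have h₂ := h₂.monL hP
    rw [Nat.sub_add_cancel hm, ha.last] at h₁
    rw [Nat.sub_add_cancel hm, hb.last] at h₂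
    simpa only [Nat.sub_add_cancel hm, ha.last, hb.last] using h₁.trans h₂.symm

theorem exists_isMinSeedCut {n : ℕ} (h : ∀ k < n, IsSeedPos P k k (k + 1)) :
    ∃ m a, IsMinSeedCut P n m a := by
  classical
  have hex : ∃ m a, IsSeedCut P n m a :=
    ⟨n, id, rfl, rfl, fun i hi => ⟨i, h i hi⟩⟩
  obtain ⟨a, ha⟩ := Nat.find_spec hex
  refine ⟨_, a, ha, fun i j hij hj hk => ?_⟩
  refine Nat.find_min hex (m := Nat.find hex - (j - i - 1)) (by omega)
    ⟨fun t => if t ≤ i then a t else a (t + (j - i - 1)), ?_, ?_, ?_⟩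
  · simp [ha.zero]
  · rw [if_neg (by omega), Nat.sub_add_cancel (by omega), ha.last]
  · intro t ht
    rcases lt_trichotomy t i with hti | rfl | hti
    · rw [if_pos hti.le, if_pos (by omega)]
      exact ha.seed t (by omega)
    · rw [if_pos le_rfl, if_neg (by omega), show t + 1 + (j - t - 1) = j by omega]
      exact hk
    · rw [if_neg (by omega), if_neg (by omega),
        show t + 1 + (j - i - 1) = t + (j - i - 1) + 1 by omega]
      exact ha.seed _ (by omega)

theorem IsMinSeedCut.truncate (hP : IsSegment P) {N n m j k : ℕ} {b : ℕ → ℕ}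
    (hb : IsMinSeedCut P N m b) (hjm : j < m) (hn : n ≤ b (j + 1))
    (hk : IsSeedPos P (b j) k (b (j + 1))) (hkn : k < n) :
    IsMinSeedCut P n (j + 1) (fun i => if i ≤ j then b i else n) := by
  have hkb := hk.2.mono hP hn hkn
  refine ⟨⟨by simp [hb.zero], by simp, fun i hi => ?_⟩, fun i i' hii' hi' => ?_⟩
  · rcases eq_or_ne i j with rfl | hne
    · simpa using ⟨k, hk.1, hkb⟩
    · simp only [if_pos (show i ≤ j by omega), if_pos (show i + 1 ≤ j by omega)]
      exact hb.seed i (by omega)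
  · by_cases hij : i' ≤ j
    · simp only [if_pos (show i ≤ j by omega), if_pos hij]
      exact hb.minimal i i' hii' (by omega)
    · simp only [if_pos (show i ≤ j by omega), if_neg hij]
      rintro ⟨l, hl⟩
      refine hb.minimal i (j + 1) (by omega) hjm ?_
      rcases le_total l k with hlk | hkl
      · exact ⟨l, hl.1, hl.2.extend hP hlk hkn hk.2⟩
      · exact ⟨k, LeftSeed.of_rightSeed hP hkb ((hb.mono (by omega) hjm.le).trans hk.1.1) hkl
          hl.2.1 hl.1, hk.2⟩

theorem IsMinSeedCut.drop (hP : IsSegment P) {Q : ℕ → ℕ → M} {N n r m j k : ℕ} {b : ℕ → ℕ}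
    (hQ : ∀ a c k, IsSeedPos Q a k c ↔ IsSeedPos P (n + a) (n + k) (n + c))
    (hb : IsMinSeedCut P N m b) (hN : N = n + r) (hjm : j < m) (hn : b j ≤ n)
    (hk : IsSeedPos P (b j) k (b (j + 1))) (hkn : n ≤ k) :
    IsMinSeedCut Q r (m - j) (fun i => if i = 0 then 0 else b (j + i) - n) := by
  have hQ' : ∀ a c, n ≤ a → n ≤ c →
      ((∃ k, IsSeedPos Q (a - n) k (c - n)) ↔ ∃ k, IsSeedPos P a k c) := by
    intro a c ha hc
    simp only [hQ, Nat.add_sub_cancel' ha, Nat.add_sub_cancel' hc]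
    refine ⟨fun ⟨k, hk⟩ => ⟨_, hk⟩, fun ⟨k, hk⟩ => ⟨k - n, ?_⟩⟩
    rwa [Nat.add_sub_cancel' (ha.trans hk.1.1)]
  have hkb := hk.1.mono hP hn hkn
  have hbn : ∀ i, 0 < i → j + i ≤ m → n ≤ b (j + i) := by
    intro i hi him
    have := hb.mono (i := j + 1) (j := j + i) (by omega) him
    have := hk.2.1
    omega
  refine ⟨⟨by simp, ?_, fun i hi => ?_⟩, fun i i' hii' hi' => ?_⟩
  · rw [if_neg (by omega), Nat.add_sub_cancel' hjm.le, hb.last]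
    omega
  · rcases Nat.eq_zero_or_pos i with rfl | hi0
    · have := (hQ' n (b (j + 1)) le_rfl (hbn 1 one_pos hjm)).2 ⟨k, hkb, hk.2⟩
      simpa using this
    · rw [if_neg (by omega), if_neg (by omega),
        hQ' _ _ (hbn _ hi0 (by omega)) (hbn _ (by omega) (by omega))]
      exact hb.seed _ (by omega)
  · rcases Nat.eq_zero_or_pos i with rfl | hi0
    · rw [if_pos rfl, if_neg (by omega)]
      have := hQ' n (b (j + i')) le_rfl (hbn _ (by omega) (by omega))
      rw [Nat.sub_self] at this
      rw [this]
      rintro ⟨l, hl⟩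
      refine hb.minimal j (j + i') (by omega) (by omega) ?_
      rcases le_total k l with hkl | hlk
      · exact ⟨l, hl.1.extend hP hkn hkl hk.1, hl.2⟩
      · exact ⟨k, hk.1, RightSeed.of_leftSeed hP hkb hl.1.1 hlk
          (hk.2.1.trans_le (hb.mono (by omega) (by omega))) hl.2⟩
    · rw [if_neg (by omega), if_neg (by omega),
        hQ' _ _ (hbn _ hi0 (by omega)) (hbn _ (by omega) (by omega))]
      exact hb.minimal _ _ (by omega) (by omega)

theorem IsMinSeedCut.congr {P Q : ℕ → ℕ → M} {n m : ℕ} {a : ℕ → ℕ} (h : IsMinSeedCut P n m a)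
    (hPQ : ∀ a k c, c ≤ n → (IsSeedPos P a k c ↔ IsSeedPos Q a k c)) : IsMinSeedCut Q n m a := by
  have hle : ∀ {j}, j ≤ m → a j ≤ n := fun hj => h.last ▸ h.mono hj le_rfl
  refine ⟨⟨h.zero, h.last, fun i hi => ?_⟩, fun i j hij hj ⟨k, hk⟩ => ?_⟩
  · obtain ⟨k, hk⟩ := h.seed i hi
    exact ⟨k, (hPQ _ _ _ (hle hi)).1 hk⟩
  · exact h.minimal i j hij hj ⟨k, (hPQ _ _ _ (hle hj)).2 hk⟩

/-- A seed of the segment `F = [c, n)` is a seed of `[0, n)` if `F 𝓛 F [0, n)`. -/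
theorem IsSeedPos.of_mul_right (hP : IsSegment P) {c k n : ℕ} {y : M} (hk : IsSeedPos P c k n)
    (hy : y * (P c n * P 0 n) = P c n) : IsSeedPos P 0 k n := by
  have hR := (hk.mono hP le_rfl hk.1.1 hk.2.1 le_rfl).2
  obtain ⟨⟨h₁, y₀, hy₀⟩, h₂, z, hz⟩ := hk
  refine ⟨⟨Nat.zero_le _, y₀ * (y * P c n), ?_⟩, hR⟩
  have hz₀ : ∀ a ≤ k, P a n * z = P a (k + 1) := by
    intro a ha
    rw [← hP a k n ha h₂.le, mul_assoc, hz, hP _ _ _ ha (Nat.le_succ k)]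
  rw [← hz₀ 0 (Nat.zero_le _), ← hy₀, ← hz₀ c h₁, ← mul_assoc, mul_assoc y₀, mul_assoc y, hy,
    mul_assoc]

/-- A seed of the segment `F = [0, c)` is a seed of `[0, n)` if `F 𝓡 [0, n) F`. -/
theorem IsSeedPos.of_mul_left (hP : IsSegment P) {c k n : ℕ} {y : M} (hk : IsSeedPos P 0 k c)
    (hkn : k < n) (hy : P 0 n * P 0 c * y = P 0 c) : IsSeedPos P 0 k n := by
  obtain ⟨⟨h₁, y₀, hy₀⟩, h₂, z, hz⟩ := hk
  refine ⟨⟨h₁, y₀, hy₀⟩, hkn, P 0 c * y * z, ?_⟩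
  have hz₀ : P 0 c * z = P 0 (k + 1) := by
    rw [← hP 0 k c h₁ h₂.le, mul_assoc, hz, hP _ _ _ h₁ (Nat.le_succ k)]
  have hn : y₀ * P 0 n = P k n := by
    rw [← hP 0 (k + 1) n (by omega) hkn, ← mul_assoc, hy₀, hP _ _ _ (Nat.le_succ k) hkn]
  rw [← hn, ← hy₀, ← hz₀, mul_assoc y₀, ← mul_assoc (P 0 n), ← mul_assoc (P 0 n), hy]

end MonoidGreen

section WordValue

variable {S : Type*} [Semigroup S]

/-- The element of IG(E), with an identity adjoined, represented by a letter. -/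
def letterVal (e : IdemE S) : WithOne (IG S) := (igBar (FreeSemigroup.of e) : IG S)

/-- The element of IG(E), with an identity adjoined, represented by a possibly empty word. -/
def wordVal (L : List (IdemE S)) : WithOne (IG S) := (L.map letterVal).prod

@[simp] theorem wordVal_nil : wordVal ([] : List (IdemE S)) = 1 := rfl

@[simp] theorem wordVal_cons (e : IdemE S) (L : List (IdemE S)) :
    wordVal (e :: L) = letterVal e * wordVal L := by simp [wordVal]

@[simp] theorem wordVal_append (L L' : List (IdemE S)) :
    wordVal (L ++ L') = wordVal L * wordVal L' := by simp [wordVal]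

theorem igBar_mul (u v : FreeSemigroup (IdemE S)) : igBar (u * v) = igBar u * igBar v := rfl

@[simp] theorem wordList_of (e : IdemE S) : wordList (FreeSemigroup.of e) = [e] := rfl

@[simp] theorem wordList_mul (u v : FreeSemigroup (IdemE S)) :
    wordList (u * v) = wordList u ++ wordList v := rfl

theorem wordList_ne_nil (u : FreeSemigroup (IdemE S)) : wordList u ≠ [] := by simp [wordList]

theorem exists_wordList_eq {L : List (IdemE S)} (hL : L ≠ []) : ∃ u, wordList u = L := by
  cases L with
  | nil => exact absurd rfl hL
  | cons e L => exact ⟨⟨e, L⟩, rfl⟩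

theorem wordVal_wordList (u : FreeSemigroup (IdemE S)) :
    wordVal (wordList u) = (igBar u : IG S) := by
  induction u using FreeSemigroup.recOnMul with
  | ih1 e => simp [letterVal]
  | ih2 e u h₁ h₂ => rw [wordList_mul, wordVal_append, h₁, h₂, igBar_mul, WithOne.coe_mul]

theorem igBar_eq_iff {u v : FreeSemigroup (IdemE S)} :
    igBar u = igBar v ↔ wordVal (wordList u) = wordVal (wordList v) := by
  rw [wordVal_wordList, wordVal_wordList, WithOne.coe_inj]

theorem letterVal_mul {e f g : IdemE S} (h : BasicPair e f) (hg : (g : S) = e * f) :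
    letterVal e * letterVal f = letterVal g := by
  have : igBar (FreeSemigroup.of e * FreeSemigroup.of f) = igBar (FreeSemigroup.of g) :=
    (Con.eq _).2 (ConGen.Rel.of _ _ ⟨e, f, g, h, hg, rfl, rfl⟩)
  rw [letterVal, letterVal, ← WithOne.coe_mul, ← igBar_mul, this, letterVal]

theorem letterVal_mul_self (e : IdemE S) : letterVal e * letterVal e = letterVal e :=
  letterVal_mul (Or.inl e.2) e.2.symm

/-- A relation between nonempty words that is reflexive, symmetric and transitive and contains
the elementary rewritings contains equality in IG(E). -/
theorem rel_of_wordVal_eq {R : List (IdemE S) → List (IdemE S) → Prop}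
    (refl : ∀ L, L ≠ [] → R L L) (symm : ∀ L L', R L L' → R L' L)
    (trans : ∀ L L' L'', L' ≠ [] → R L L' → R L' L'' → R L L'')
    (step : ∀ x y (e f g : IdemE S), BasicPair e f → (g : S) = e * f →
      R (x ++ e :: f :: y) (x ++ g :: y))
    {L L' : List (IdemE S)} (hL : L ≠ []) (hL' : L' ≠ []) (h : wordVal L = wordVal L') :
    R L L' := by
  obtain ⟨u, rfl⟩ := exists_wordList_eq hL
  obtain ⟨v, rfl⟩ := exists_wordList_eq hL'
  have huv : ConGen.Rel (fun u v => igRelBase u v) u v := (Con.eq _).1 (igBar_eq_iff.2 h)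
  suffices ∀ x y, R (x ++ wordList u ++ y) (x ++ wordList v ++ y) by simpa using this [] []
  clear h hL hL'
  induction huv with
  | of u v h =>
    obtain ⟨e, f, g, h, hg, rfl, rfl⟩ := h
    intro x y
    simpa using step x y e f g h hg
  | refl u => exact fun x y => refl _ (by simp [wordList_ne_nil])
  | symm _ ih => exact fun x y => symm _ _ (ih x y)
  | trans _ _ ih₁ ih₂ =>
    exact fun x y => trans _ _ _ (by simp [wordList_ne_nil]) (ih₁ x y) (ih₂ x y)
  | @mul u v u' v' _ _ ih₁ ih₂ =>
    intro x y
    refine trans _ (x ++ wordList (v * u') ++ y) _ (by simp [wordList_ne_nil]) ?_ ?_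
    · simpa using ih₁ x (wordList u' ++ y)
    · simpa using ih₂ (x ++ wordList v) y

/-- A word has a seed if `L = u e v` with `ue 𝓛 e 𝓡 ev`. -/
def HasSeed (L : List (IdemE S)) : Prop :=
  ∃ u e v, L = u ++ e :: v ∧ (∃ y, y * (wordVal u * letterVal e) = letterVal e) ∧
    ∃ z, letterVal e * wordVal v * z = letterVal e

theorem append_cons_eq_append_pair {A : Type*} {u v x y : List A} {k e f : A}
    (h : u ++ k :: v = x ++ e :: f :: y) :
    (∃ t, u = x ++ e :: f :: t ∧ y = t ++ k :: v) ∨ (u = x ∧ k = e ∧ v = f :: y) ∨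
      (u = x ++ [e] ∧ k = f ∧ v = y) ∨ ∃ t, x = u ++ k :: t ∧ v = t ++ e :: f :: y := by
  rcases List.append_eq_append_iff.1 h with ⟨t, rfl, ht⟩ | ⟨t, rfl, ht⟩
  · rcases t with _ | ⟨k', t⟩
    · simp_all
    · simp only [List.cons_append, List.cons.injEq] at ht
      obtain ⟨rfl, rfl⟩ := ht
      exact Or.inr (Or.inr (Or.inr ⟨t, rfl, rfl⟩))
  · rcases t with _ | ⟨e', _ | ⟨f', t⟩⟩
    · simp_all
    · simp_all
    · simp_all

theorem append_cons_eq_append_cons {A : Type*} {u v x y : List A} {k g : A}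
    (h : u ++ k :: v = x ++ g :: y) :
    (∃ t, u = x ++ g :: t ∧ y = t ++ k :: v) ∨ (u = x ∧ k = g ∧ v = y) ∨
      ∃ t, x = u ++ k :: t ∧ v = t ++ g :: y := by
  rcases List.append_eq_append_iff.1 h with ⟨t, rfl, ht⟩ | ⟨t, rfl, ht⟩
  · rcases t with _ | ⟨k', t⟩
    · simp_all
    · simp only [List.cons_append, List.cons.injEq] at ht
      obtain ⟨rfl, rfl⟩ := ht
      exact Or.inr (Or.inr ⟨t, rfl, rfl⟩)
  · rcases t with _ | ⟨e', t⟩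
    · simp_all
    · simp_all

theorem HasSeed.of_pair {e f g : IdemE S} (h : BasicPair e f) (hg : (g : S) = e * f)
    {x y : List (IdemE S)} (hs : HasSeed (x ++ e :: f :: y)) : HasSeed (x ++ g :: y) := by
  have hm := letterVal_mul h hg
  obtain ⟨u, k, v, huv, ⟨b, hb⟩, c, hc⟩ := hs
  rcases append_cons_eq_append_pair huv.symm with ⟨t, rfl, rfl⟩ | ⟨rfl, rfl, rfl⟩ |
    ⟨rfl, rfl, rfl⟩ | ⟨t, rfl, rfl⟩
  · exact ⟨x ++ g :: t, k, v, by simp, ⟨b, by simpa [← hm, mul_assoc] using hb⟩, c, hc⟩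
  · refine ⟨u, g, y, rfl, ⟨b, ?_⟩, c * letterVal g, ?_⟩
    · rw [← hm, ← mul_assoc, ← mul_assoc, mul_assoc b, hb]
    · rw [wordVal_cons, ← mul_assoc, hm] at hc
      rw [← mul_assoc, hc, ← hm, ← mul_assoc, letterVal_mul_self]
  · refine ⟨x, g, v, rfl, ⟨letterVal g * b, ?_⟩, c, ?_⟩
    · rw [wordVal_append, wordVal_cons, wordVal_nil, mul_one, mul_assoc, hm] at hb
      rw [mul_assoc, hb, ← hm, mul_assoc, letterVal_mul_self]
    · rw [← hm, mul_assoc, mul_assoc, ← mul_assoc (letterVal k), hc]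
  · exact ⟨u, k, t ++ g :: y, by simp, ⟨b, hb⟩, c, by simpa [← hm, mul_assoc] using hc⟩

theorem BasicPair.exists_mul_eq {e f g : IdemE S} (h : BasicPair e f) (hg : (g : S) = e * f) :
    (∃ d, letterVal g * d = letterVal e) ∨ ∃ d, d * letterVal g = letterVal f := by
  rcases h with h | h | h | h
  · obtain rfl : g = e := Subtype.ext (hg.trans h)
    exact Or.inl ⟨1, mul_one _⟩
  · obtain rfl : g = f := Subtype.ext (hg.trans h)
    exact Or.inr ⟨1, one_mul _⟩
  · have : (g : S) * e = e := by rw [hg, mul_assoc, h, e.2]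
    exact Or.inl ⟨_, letterVal_mul (Or.inr (Or.inl this)) this.symm⟩
  · have : (f : S) * g = f := by rw [hg, ← mul_assoc, h, f.2]
    exact Or.inr ⟨_, letterVal_mul (Or.inl this) this.symm⟩

theorem HasSeed.to_pair {e f g : IdemE S} (h : BasicPair e f) (hg : (g : S) = e * f)
    {x y : List (IdemE S)} (hs : HasSeed (x ++ g :: y)) : HasSeed (x ++ e :: f :: y) := by
  have hm := letterVal_mul h hg
  obtain ⟨u, k, v, huv, ⟨b, hb⟩, c, hc⟩ := hs
  rcases append_cons_eq_append_cons huv.symm with ⟨t, rfl, rfl⟩ | ⟨rfl, rfl, rfl⟩ | ⟨t, rfl, rfl⟩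
  · exact ⟨x ++ e :: f :: t, k, v, by simp, ⟨b, by simpa [← hm, mul_assoc] using hb⟩, c, hc⟩
  · rcases h.exists_mul_eq hg with ⟨d, hd⟩ | ⟨d, hd⟩
    · refine ⟨u, e, f :: v, rfl, ⟨b, ?_⟩, c * d, ?_⟩
      · rw [← hd, ← mul_assoc, ← mul_assoc, mul_assoc b, hb]
      · rw [wordVal_cons, ← mul_assoc (letterVal e), hm, ← mul_assoc, hc, hd]
    · refine ⟨u ++ [e], f, v, by simp, ⟨d * b, ?_⟩, c, ?_⟩
      · rw [wordVal_append, wordVal_cons, wordVal_nil, mul_one, mul_assoc (wordVal u), hm,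
          mul_assoc, hb, hd]
      · rw [← hd, mul_assoc, mul_assoc, ← mul_assoc (letterVal k), hc]
  · exact ⟨u, k, t ++ e :: f :: y, by simp, ⟨b, hb⟩, c, by simpa [← hm, mul_assoc] using hc⟩

theorem hasSeed_congr {L L' : List (IdemE S)} (hL : L ≠ []) (hL' : L' ≠ [])
    (h : wordVal L = wordVal L') : HasSeed L ↔ HasSeed L' :=
  rel_of_wordVal_eq (R := fun L L' => HasSeed L ↔ HasSeed L') (fun _ _ => Iff.rfl)
    (fun _ _ => Iff.symm) (fun _ _ _ _ => Iff.trans)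
    (fun _ _ _ _ _ hb hg => ⟨HasSeed.of_pair hb hg, HasSeed.to_pair hb hg⟩) hL hL' h

/-- The segment of a word from position `a` up to but excluding position `b`. -/
def wordSegment {A : Type*} (L : List A) (a b : ℕ) : List A := (L.take b).drop a

/-- The value of a segment of a word. -/
def segVal (L : List (IdemE S)) (a b : ℕ) : WithOne (IG S) := wordVal (wordSegment L a b)

theorem wordSegment_append_wordSegment {A : Type*} (L : List A) {a b c : ℕ} (hab : a ≤ b)
    (hbc : b ≤ c) : wordSegment L a b ++ wordSegment L b c = wordSegment L a c := by
  have h : L.take b = (L.take c).take b := by rw [List.take_take, min_eq_left hbc]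
  rw [wordSegment, wordSegment, wordSegment, h]
  generalize L.take c = K
  rcases le_total b K.length with hb | hb
  · conv_rhs => rw [← List.take_append_drop b K, List.drop_append_of_le_length (by simp; omega)]
  · rw [List.take_of_length_le hb, List.drop_of_length_le hb, List.append_nil]

theorem isSegment_segVal (L : List (IdemE S)) : IsSegment (segVal L) := by
  intro a b c hab hbc
  rw [segVal, segVal, segVal, ← wordVal_append, wordSegment_append_wordSegment L hab hbc]

theorem length_wordSegment {A : Type*} (L : List A) {a b : ℕ} (hb : b ≤ L.length) :
    (wordSegment L a b).length = b - a := by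
  simp [wordSegment, hb]

theorem wordSegment_wordSegment {A : Type*} (L : List A) {a b c d : ℕ} (h : a + d ≤ b) :
    wordSegment (wordSegment L a b) c d = wordSegment L (a + c) (a + d) := by
  simp only [wordSegment, List.take_drop, List.take_take, List.drop_drop]
  rw [min_eq_left h]

theorem segVal_letter (u v : List (IdemE S)) (e : IdemE S) :
    segVal (u ++ e :: v) u.length (u.length + 1) = letterVal e := by
  simp [segVal, wordSegment, List.take_append]

theorem segVal_prefix (u v : List (IdemE S)) (e : IdemE S) :
    segVal (u ++ e :: v) 0 (u.length + 1) = wordVal u * letterVal e := by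
  simp [segVal, wordSegment, List.take_append, List.take_of_length_le (Nat.le_succ u.length)]

theorem segVal_suffix (u v : List (IdemE S)) (e : IdemE S) :
    segVal (u ++ e :: v) u.length (u ++ e :: v).length = letterVal e * wordVal v := by
  rw [segVal, wordSegment, List.take_length]
  simp

theorem hasSeed_iff (L : List (IdemE S)) :
    HasSeed L ↔ ∃ k, IsSeedPos (segVal L) 0 k L.length := by
  constructor
  · rintro ⟨u, e, v, rfl, hy, hz⟩
    refine ⟨u.length, ⟨Nat.zero_le _, ?_⟩, by simp, ?_⟩
    · rwa [segVal_letter, segVal_prefix]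
    · rwa [segVal_letter, segVal_suffix]
  · rintro ⟨k, ⟨_, hy⟩, hk, hz⟩
    obtain ⟨u, e, v, rfl, rfl⟩ : ∃ u e v, L = u ++ e :: v ∧ k = u.length :=
      ⟨L.take k, L[k], L.drop (k + 1), by simp, by simp; omega⟩
    rw [segVal_letter, segVal_prefix] at hy
    rw [segVal_letter, segVal_suffix] at hz
    exact ⟨u, e, v, rfl, hy, hz⟩

theorem hasSeed_wordSegment_iff (L : List (IdemE S)) {a b : ℕ} (hab : a ≤ b) (hb : b ≤ L.length) :
    HasSeed (wordSegment L a b) ↔ ∃ k, IsSeedPos (segVal L) a k b := by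
  have hseg : ∀ c d, d ≤ b - a → segVal (wordSegment L a b) c d = segVal L (a + c) (a + d) := by
    intro c d hd
    rw [segVal, segVal, wordSegment_wordSegment L (by omega)]
  rw [hasSeed_iff, length_wordSegment L hb]
  have key : ∀ k, IsSeedPos (segVal (wordSegment L a b)) 0 k (b - a) ↔
      IsSeedPos (segVal L) a (a + k) b := by
    intro k
    by_cases hk : k < b - a
    · simp only [IsSeedPos, LeftSeed, RightSeed, hseg _ (b - a) le_rfl, hseg _ (k + 1) hk,
        Nat.add_sub_cancel' hab, add_zero, ← add_assoc]
      refine and_congr (and_congr_left' ?_) (and_congr_left' ?_) <;> omega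
    · exact iff_of_false (fun h => hk h.2.1) (fun h => hk (by have := h.2.1; omega))
  simp only [key]
  exact ⟨fun ⟨k, hk⟩ => ⟨_, hk⟩, fun ⟨k, hk⟩ => ⟨k - a, by rwa [Nat.add_sub_cancel' hk.1.1]⟩⟩

theorem exists_isSeedPos_congr {w w' : List (IdemE S)} {a b a' b' : ℕ} (hab : a < b)
    (hb : b ≤ w.length) (hab' : a' < b') (hb' : b' ≤ w'.length)
    (h : segVal w a b = segVal w' a' b') :
    (∃ k, IsSeedPos (segVal w) a k b) ↔ ∃ k, IsSeedPos (segVal w') a' k b' := by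
  have hne : ∀ {L : List (IdemE S)} {c d : ℕ}, c < d → d ≤ L.length → wordSegment L c d ≠ [] := by
    intro L c d hcd hd
    rw [← List.length_pos_iff, length_wordSegment L hd]
    omega
  rw [← hasSeed_wordSegment_iff w hab.le hb, ← hasSeed_wordSegment_iff w' hab'.le hb']
  exact hasSeed_congr (hne hab hb) (hne hab' hb') h

theorem exists_isMinSeedCut_segVal (w : List (IdemE S)) :
    ∃ m a, IsMinSeedCut (segVal w) w.length m a := by
  refine exists_isMinSeedCut fun k hk => ⟨⟨le_rfl, 1, ?_⟩, Nat.lt_succ_self k, 1, ?_⟩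
  · rw [one_mul]
  · rw [mul_one]

theorem IsMinSeedCut.transport {w w' : List (IdemE S)} {σ : ℕ → ℕ} (hσ : StrictMono σ)
    (h₀ : σ 0 = 0) (hlen : σ w'.length = w.length)
    (hval : ∀ a b, a ≤ b → segVal w (σ a) (σ b) = segVal w' a b) {m : ℕ} {a : ℕ → ℕ}
    (h : IsMinSeedCut (segVal w') w'.length m a) :
    IsMinSeedCut (segVal w) w.length m (fun i => σ (a i)) := by
  have key : ∀ i j, i < j → j ≤ m → ((∃ k, IsSeedPos (segVal w) (σ (a i)) k (σ (a j))) ↔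
      ∃ k, IsSeedPos (segVal w') (a i) k (a j)) := by
    intro i j hij hj
    obtain ⟨k, hk⟩ := h.seed i (by omega)
    have h₁ := h.mono (i := i + 1) (j := j) hij hj
    have h₂ : a i < a j := (hk.1.1.trans_lt hk.2.1).trans_le h₁
    have h₃ : a j ≤ w'.length := by
      rw [← h.last]
      exact h.mono hj le_rfl
    refine exists_isSeedPos_congr (hσ h₂) ?_ h₂ h₃ (hval _ _ h₂.le)
    rw [← hlen]
    exact hσ.monotone h₃
  exact ⟨⟨by rw [h.zero, h₀], by rw [h.last, hlen],
    fun i hi => (key i (i + 1) (by omega) hi).2 (h.seed i hi)⟩,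
    fun i j hij hj hex => h.minimal i j hij hj ((key i j (by omega) hj).1 hex)⟩

/-- Any two minimal divisions of the two words are similar. -/
def CutsSimilar (w w' : List (IdemE S)) : Prop :=
  ∀ m s a b, IsMinSeedCut (segVal w) w.length m a → IsMinSeedCut (segVal w') w'.length s b →
    GreenSimilar m s (fun i => segVal w (a i) (a (i + 1))) (fun i => segVal w' (b i) (b (i + 1)))

theorem cutsSimilar_refl {w : List (IdemE S)} (hw : w ≠ []) : CutsSimilar w w :=
  fun _ _ _ _ ha hb => ha.greenSimilar (isSegment_segVal w) hb (List.length_pos_iff.2 hw)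

theorem cutsSimilar_of_transport {w w' : List (IdemE S)} (hw : w ≠ []) {σ : ℕ → ℕ}
    (hσ : StrictMono σ) (h₀ : σ 0 = 0) (hlen : σ w'.length = w.length)
    (hval : ∀ a b, a ≤ b → segVal w (σ a) (σ b) = segVal w' a b) : CutsSimilar w w' := by
  intro m s a b ha hb
  have h := cutsSimilar_refl hw _ _ _ _ ha (hb.transport hσ h₀ hlen hval)
  obtain ⟨rfl, h₁, h₂, h₃⟩ := h
  have hm := ha.pos (List.length_pos_iff.2 hw)
  have heq : ∀ i < m, segVal w (σ (b i)) (σ (b (i + 1))) = segVal w' (b i) (b (i + 1)) :=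
    fun i hi => hval _ _ (hb.mono (Nat.le_succ i) hi)
  simp only [heq 0 hm] at h₂
  simp only [heq (m - 1) (by omega)] at h₃
  exact ⟨rfl, fun i hi => by simpa only [heq i hi] using h₁ i hi, h₂, h₃⟩

theorem segVal_pair {e f g : IdemE S} (h : BasicPair e f) (hg : (g : S) = e * f)
    (x y : List (IdemE S)) {a b : ℕ} (hab : a ≤ b) :
    segVal (x ++ e :: f :: y) (if a ≤ x.length then a else a + 1)
        (if b ≤ x.length then b else b + 1) = segVal (x ++ g :: y) a b := by
  have hm := letterVal_mul h hg
  by_cases hb : b ≤ x.length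
  · rw [if_pos hb, if_pos (hab.trans hb)]
    simp [segVal, wordSegment, List.take_append_of_le_length hb]
  · obtain ⟨c, rfl⟩ : ∃ c, b = x.length + 1 + c := ⟨b - (x.length + 1), by omega⟩
    have h₁ : (x ++ e :: f :: y).take (x.length + 1 + c + 1) = x ++ e :: f :: y.take c := by
      rw [show x.length + 1 + c + 1 = x.length + (c + 1 + 1) by omega, List.take_length_add_append]
      rfl
    have h₂ : (x ++ g :: y).take (x.length + 1 + c) = x ++ g :: y.take c := by
      rw [show x.length + 1 + c = x.length + (c + 1) by omega, List.take_length_add_append]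
      rfl
    rw [if_neg hb, segVal, segVal, wordSegment, wordSegment, h₁, h₂]
    by_cases ha : a ≤ x.length
    · rw [if_pos ha, List.drop_append_of_le_length ha, List.drop_append_of_le_length ha]
      simp [← hm, mul_assoc]
    · obtain ⟨d, rfl⟩ : ∃ d, a = x.length + 1 + d := ⟨a - (x.length + 1), by omega⟩
      rw [if_neg ha, show x.length + 1 + d + 1 = x.length + (d + 1 + 1) by omega,
        show x.length + 1 + d = x.length + (d + 1) by omega, List.drop_length_add_append,
        List.drop_length_add_append]
      rfl

theorem cutsSimilar_of_wordVal_eq {w w' : List (IdemE S)} (hw : w ≠ []) (hw' : w' ≠ [])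
    (h : wordVal w = wordVal w') : CutsSimilar w w' := by
  refine rel_of_wordVal_eq (fun _ => cutsSimilar_refl)
    (fun _ _ h m s a b ha hb => (h s m b a hb ha).symm) ?_ ?_ hw hw' h
  · intro w w' w'' _ h h' m s a b ha hb
    obtain ⟨t, c, hc⟩ := exists_isMinSeedCut_segVal w'
    exact (h _ _ _ _ ha hc).trans (h' _ _ _ _ hc hb)
  · intro x y e f g h hg
    refine cutsSimilar_of_transport (by simp) (σ := fun i => if i ≤ x.length then i else i + 1)
      ?_ (by simp) (by simp; omega) (fun _ _ => segVal_pair h hg x y)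
    intro i j hij
    dsimp only
    split_ifs <;> omega

theorem hasSeed_of_idempotent {w : List (IdemE S)} (hw : w ≠ [])
    (h : wordVal w * wordVal w = wordVal w) : HasSeed w := by
  have hn := List.length_pos_iff.2 hw
  have hPw := isSegment_segVal w
  have hPW := isSegment_segVal (w ++ w)
  have hlen : (w ++ w).length = w.length + w.length := List.length_append
  have hleft : ∀ a c, c ≤ w.length → segVal (w ++ w) a c = segVal w a c := by
    intro a c hc
    rw [segVal, segVal, wordSegment, wordSegment, List.take_append_of_le_length hc]
  have hright : ∀ a c, segVal (w ++ w) (w.length + a) (w.length + c) = segVal w a c := by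
    intro a c
    rw [segVal, segVal, wordSegment, wordSegment, List.take_length_add_append,
      List.drop_length_add_append]
  have hseedl : ∀ a k c, c ≤ w.length →
      (IsSeedPos (segVal (w ++ w)) a k c ↔ IsSeedPos (segVal w) a k c) := by
    intro a k c hc
    by_cases hk : k < c
    · simp only [IsSeedPos, LeftSeed, RightSeed, hleft _ c hc, hleft _ (k + 1) (by omega)]
    · exact iff_of_false (fun h => hk h.2.1) (fun h => hk h.2.1)
  have hseedr : ∀ a c k, IsSeedPos (segVal w) a k c ↔
      IsSeedPos (segVal (w ++ w)) (w.length + a) (w.length + k) (w.length + c) := by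
    intro a c k
    simp only [IsSeedPos, LeftSeed, RightSeed, add_assoc, hright]
    refine and_congr (and_congr_left' ?_) (and_congr_left' ?_) <;> omega
  have hval : wordVal w = wordVal (w ++ w) := by rw [wordVal_append, h]
  have hsim : CutsSimilar w (w ++ w) := cutsSimilar_of_wordVal_eq hw (by simp [hw]) hval
  obtain ⟨m, b, hb⟩ := exists_isMinSeedCut_segVal (w ++ w)
  obtain ⟨j, hjm, hj₁, hj₂⟩ := hb.exists_mem (l := w.length - 1) (by omega)
  obtain ⟨k, hk⟩ := hb.seed j hjm
  have hw₀ : segVal w 0 w.length = wordVal w := by simp [segVal, wordSegment]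
  rw [hasSeed_iff]
  rcases lt_or_ge k w.length with hkn | hkn
  · have hjn : w.length ≤ b (j + 1) := by omega
    have ha := (hb.truncate hPW hjm hjn hk hkn).congr hseedl
    have hks := (hseedl _ _ _ le_rfl).1 (hk.mono hPW le_rfl hk.1.1 hkn hjn)
    obtain ⟨rfl, -, -, -, y, hy⟩ := hsim _ _ _ _ ha hb
    refine ⟨k, hks.of_mul_right (y := y) hPw ?_⟩
    simp only [Nat.add_sub_cancel, le_refl, if_true, hb.last, hlen,
      if_neg (Nat.not_succ_le_self j)] at hy
    rw [← hPW _ w.length _ (by omega) (by omega), hleft _ _ le_rfl] at hy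
    have h₁ := hright 0 w.length
    rw [add_zero] at h₁
    rwa [h₁] at hy
  · have ha := hb.drop hPW hseedr hlen hjm (by omega) hk hkn
    obtain ⟨hmj, -, ⟨-, y, hy⟩, -⟩ := hsim _ _ _ _ ha hb
    obtain rfl : j = 0 := by omega
    have hkb : k < b 1 := hk.2.1
    have hks : IsSeedPos (segVal w) 0 (k - w.length) (b 1 - w.length) := by
      rw [hseedr, add_zero, Nat.add_sub_cancel' hkn, Nat.add_sub_cancel' (by omega)]
      exact hk.mono hPW (by omega) hkn hkb le_rfl
    have hb₁ : b 1 ≤ w.length + w.length := by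
      rw [← hlen, ← hb.last]
      exact hb.mono hjm le_rfl
    refine ⟨_, hks.of_mul_left (y := y) hPw (by omega) ?_⟩
    have h₁ := hright 0 (b 1 - w.length)
    rw [Nat.add_sub_cancel' (by omega), add_zero] at h₁
    simp only [hb.zero, zero_add, if_true, one_ne_zero, if_false] at hy
    rwa [← hPW 0 w.length _ (by omega) (by omega), h₁,
      hleft _ _ le_rfl] at hy

theorem HasSeed.append_left {w : List (IdemE S)} (x : List (IdemE S)) {k b : ℕ}
    (h : IsSeedPos (segVal (w ++ x)) 0 k b) (hk : k < w.length) (hb : w.length ≤ b) :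
    HasSeed w := by
  have := (hasSeed_wordSegment_iff (w ++ x) (Nat.zero_le w.length) (by simp)).2
    ⟨k, h.mono (isSegment_segVal _) le_rfl (Nat.zero_le _) hk hb⟩
  simpa [wordSegment] using this

theorem hasSeed_of_mul_mul_eq {w β : List (IdemE S)} (hw : w ≠ [])
    (h : wordVal w * wordVal β * wordVal w = wordVal w) : HasSeed w := by
  have hPW := isSegment_segVal (w ++ β ++ w)
  have h₁ : HasSeed (w ++ β) := hasSeed_of_idempotent (by simp [hw]) (by
    rw [wordVal_append, ← mul_assoc, h])
  have h₂ : HasSeed (β ++ w) := hasSeed_of_idempotent (by simp [hw]) (by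
    rw [wordVal_append, mul_assoc, ← mul_assoc (wordVal w), h])
  have hl : (w ++ β ++ w).length = w.length + β.length + w.length := by simp [add_assoc]
  have hs₁ : wordSegment (w ++ β ++ w) 0 (w.length + β.length) = w ++ β := by
    rw [← List.length_append]
    simp only [wordSegment, List.drop_zero, List.take_left]
  have hs₂ : wordSegment (w ++ β ++ w) w.length (w.length + β.length + w.length) = β ++ w := by
    rw [wordSegment, ← hl, List.take_length, List.append_assoc, List.drop_left]
  have hs₃ : wordSegment (w ++ β ++ w) (w.length + β.length) (w.length + β.length + w.length)
      = w := by
    rw [wordSegment, ← hl, List.take_length, ← List.length_append, List.drop_left]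
  rw [← hs₁, hasSeed_wordSegment_iff _ (Nat.zero_le _) (by omega)] at h₁
  rw [← hs₂, hasSeed_wordSegment_iff _ (by omega) (by omega)] at h₂
  obtain ⟨k, hk⟩ := h₁
  obtain ⟨l, hl'⟩ := h₂
  have hk₂ := hk.2.1
  have hl₁ := hl'.1.1
  rcases lt_or_ge k w.length with hkw | hkw
  · rw [List.append_assoc] at hk
    exact HasSeed.append_left _ hk hkw (by omega)
  rcases le_or_gt (w.length + β.length) l with hlw | hlw
  · rw [← hs₃, hasSeed_wordSegment_iff _ (by omega) (by omega)]
    exact ⟨l, hl'.mono hPW (by omega) hlw hl'.2.1 le_rfl⟩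
  have hR : RightSeed (segVal (w ++ β ++ w)) k (w.length + β.length + w.length) := by
    rcases le_total k l with hkl | hlk
    · exact hk.2.extend hPW hkl hlw hl'.2
    · exact RightSeed.of_leftSeed hPW (hk.1.mono hPW (Nat.zero_le _) hkw) hl₁ hlk (by omega) hl'.2
  have hW : HasSeed (w ++ β ++ w) := (hasSeed_iff _).2 ⟨k, hk.1, hl ▸ hR⟩
  refine (hasSeed_congr (by simp [hw]) hw ?_).1 hW
  rw [wordVal_append, wordVal_append, h]

theorem igBar_surjective : Function.Surjective (igBar (S := S)) := Quotient.mk_surjective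

theorem isRegularElem_igBar_iff (u : FreeSemigroup (IdemE S)) :
    IsRegularElem (igBar u) ↔ HasSeed (wordList u) := by
  constructor
  · rintro ⟨b, hb⟩
    obtain ⟨β, rfl⟩ := igBar_surjective b
    refine hasSeed_of_mul_mul_eq (β := wordList β) (wordList_ne_nil u) ?_
    rw [wordVal_wordList, wordVal_wordList, ← WithOne.coe_mul, ← WithOne.coe_mul, hb]
  · rintro ⟨x, e, y, hu, ⟨b, hb⟩, c, hc⟩
    have h : wordVal (wordList u) * (c * letterVal e * b) * wordVal (wordList u) =
        wordVal (wordList u) := by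
      rw [hu, wordVal_append, wordVal_cons]
      calc _ = wordVal x * (letterVal e * wordVal y * c) * letterVal e *
            (b * (wordVal x * letterVal e)) * wordVal y := by simp only [mul_assoc]
        _ = _ := by
          rw [hb, hc, mul_assoc (wordVal x), letterVal_mul_self, mul_assoc (wordVal x),
            letterVal_mul_self, mul_assoc]
    rw [wordVal_wordList] at h
    generalize c * letterVal e * b = d at h
    induction d using WithOne.recOneCoe with
    | one =>
      refine ⟨igBar u, ?_⟩
      rw [mul_one, ← WithOne.coe_mul, WithOne.coe_inj] at h
      rw [h, h]
    | coe d => exact ⟨d, by rwa [← WithOne.coe_mul, ← WithOne.coe_mul, WithOne.coe_inj] at h⟩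

theorem greenR_of_monR {T : Type*} [Semigroup T] {a b : T} (h : MonR (a : WithOne T) b) :
    GreenR a b := by
  obtain ⟨⟨x, hx⟩, y, hy⟩ := h
  induction x using WithOne.recOneCoe with
  | one => exact Or.inl (WithOne.coe_inj.1 (by rwa [mul_one] at hx))
  | coe x =>
    induction y using WithOne.recOneCoe with
    | one => exact Or.inl (WithOne.coe_inj.1 (by rwa [mul_one, eq_comm] at hy))
    | coe y => exact Or.inr ⟨x, y, WithOne.coe_inj.1 hx, WithOne.coe_inj.1 hy⟩

theorem greenL_of_monL {T : Type*} [Semigroup T] {a b : T} (h : MonL (a : WithOne T) b) :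
    GreenL a b := by
  obtain ⟨⟨x, hx⟩, y, hy⟩ := h
  induction x using WithOne.recOneCoe with
  | one => exact Or.inl (WithOne.coe_inj.1 (by rwa [one_mul] at hx))
  | coe x =>
    induction y using WithOne.recOneCoe with
    | one => exact Or.inl (WithOne.coe_inj.1 (by rwa [one_mul, eq_comm] at hy))
    | coe y => exact Or.inr ⟨x, y, WithOne.coe_inj.1 hx, WithOne.coe_inj.1 hy⟩

theorem greenD_of_monD {T : Type*} [Semigroup T] {a b : T} (h : MonD (a : WithOne T) b) :
    GreenD a b := by
  obtain ⟨c, h₁, h₂⟩ := h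
  induction c using WithOne.recOneCoe with
  | one =>
    obtain ⟨⟨x, hx⟩, y, hy⟩ := h₁
    induction x using WithOne.recOneCoe with
    | one => exact absurd (by rwa [mul_one] at hx) (WithOne.coe_ne_one (a := a))
    | coe x => exact absurd hx (WithOne.coe_ne_one (a := a * x))
  | coe c => exact ⟨c, greenR_of_monR h₁, greenL_of_monL h₂⟩

/-- The concatenation of the words `p 1, …, p i`. -/
def prefixWord (p : ℕ → FreeSemigroup (IdemE S)) (i : ℕ) : List (IdemE S) :=
  ((List.range i).map fun j => wordList (p (j + 1))).flatten

theorem prefixWord_succ (p : ℕ → FreeSemigroup (IdemE S)) (i : ℕ) :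
    prefixWord p (i + 1) = prefixWord p i ++ wordList (p (i + 1)) := by
  simp [prefixWord, List.range_succ]

theorem prefixWord_add (p : ℕ → FreeSemigroup (IdemE S)) (i k : ℕ) :
    prefixWord p (i + k + 1) = prefixWord p i ++ wordList (blockProd p (i + 1) k) := by
  induction k with
  | zero => exact prefixWord_succ p i
  | succ k ih =>
    rw [prefixWord_succ, ← add_assoc, ih, blockProd, wordList_mul, List.append_assoc]
    congr 4
    omega

theorem wordSegment_prefixWord (p : ℕ → FreeSemigroup (IdemE S)) {i k m : ℕ} (h : i + k + 1 ≤ m) :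
    wordSegment (prefixWord p m) (prefixWord p i).length (prefixWord p (i + k + 1)).length =
      wordList (blockProd p (i + 1) k) := by
  obtain ⟨L, hL⟩ : ∃ L, prefixWord p m = prefixWord p (i + k + 1) ++ L := by
    rcases h.eq_or_lt with rfl | h
    · exact ⟨[], (List.append_nil _).symm⟩
    · obtain ⟨d, rfl⟩ := Nat.exists_eq_add_of_lt h
      exact ⟨_, prefixWord_add p _ d⟩
  rw [wordSegment, hL, List.take_left, prefixWord_add, List.drop_left]

theorem IsMinRFact.isMinSeedCut {u : FreeSemigroup (IdemE S)} {m : ℕ}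
    {p : ℕ → FreeSemigroup (IdemE S)} (h : IsMinRFact u m p) :
    wordList u = prefixWord p m ∧ IsMinSeedCut (segVal (wordList u)) (wordList u).length m
      (fun i => (prefixWord p i).length) := by
  obtain ⟨⟨hm, hu, hreg⟩, hmin⟩ := h
  have hu' : wordList u = prefixWord p m := by
    have := prefixWord_add p 0 (m - 1)
    rw [zero_add, Nat.sub_add_cancel hm, zero_add, hu] at this
    exact this.symm
  have key : ∀ i k, i + k + 1 ≤ m →
      ((∃ l, IsSeedPos (segVal (prefixWord p m)) (prefixWord p i).length l
      (prefixWord p (i + k + 1)).length) ↔ IsRegularElem (igBar (blockProd p (i + 1) k))) := by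
    intro i k hik
    rw [isRegularElem_igBar_iff, ← wordSegment_prefixWord p hik, hasSeed_wordSegment_iff]
    · simp [prefixWord_add]
    · rcases hik.eq_or_lt with rfl | h
      · exact le_rfl
      · obtain ⟨d, rfl⟩ := Nat.exists_eq_add_of_lt h
        simp [prefixWord_add p (i + k + 1) d]
  refine ⟨hu', ⟨rfl, by rw [hu'], fun i hi => ?_⟩, fun i j hij hj => ?_⟩
  · rw [hu']
    exact (key i 0 hi).2 (hreg (i + 1) (by omega) hi)
  · obtain ⟨k, rfl⟩ : ∃ k, j = i + k + 1 := ⟨j - i - 1, by omega⟩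
    rw [hu', key i k hj]
    have := hmin (i + 1) (i + k + 1) (by omega) (by omega) hj
    rwa [show i + k + 1 - (i + 1) = k by omega] at this

theorem IsMinRFact.segVal_eq {u : FreeSemigroup (IdemE S)} {m : ℕ}
    {p : ℕ → FreeSemigroup (IdemE S)} (h : IsMinRFact u m p) {i : ℕ} (hi : i < m) :
    segVal (wordList u) (prefixWord p i).length (prefixWord p (i + 1)).length =
      igBar (p (i + 1)) := by
  rw [h.isMinSeedCut.1, segVal, wordSegment_prefixWord p (k := 0) hi, wordVal_wordList]
  rfl

end WordValue

theorem stmt4 {S : Type*} [Semigroup S] [Finite (IdemE S)]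
    (u v : FreeSemigroup (IdemE S)) (huv : igBar u = igBar v)
    (m s : ℕ) (p q : ℕ → FreeSemigroup (IdemE S))
    (hp : IsMinRFact u m p) (hq : IsMinRFact v s q) :
    m = s ∧ (∀ i, 1 ≤ i → i ≤ m → GreenD (igBar (p i)) (igBar (q i))) ∧
      GreenR (igBar (p 1)) (igBar (q 1)) ∧ GreenL (igBar (p m)) (igBar (q m)) := by
  have hm := hp.1.1
  obtain ⟨rfl, hD, hR, hL⟩ := cutsSimilar_of_wordVal_eq (wordList_ne_nil u) (wordList_ne_nil v)
    (igBar_eq_iff.1 huv) _ _ _ _ hp.isMinSeedCut.2 hq.isMinSeedCut.2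
  have hm' : m - 1 < m := by omega
  simp only [hp.segVal_eq hm, hq.segVal_eq hm] at hR
  simp only [hp.segVal_eq hm', hq.segVal_eq hm'] at hL
  simp only [Nat.sub_add_cancel hm] at hL
  refine ⟨rfl, fun i hi him => ?_, greenR_of_monR hR, greenL_of_monL hL⟩
  obtain ⟨j, rfl⟩ := Nat.exists_eq_add_of_le' hi
  have := hD j him
  simp only [hp.segVal_eq him, hq.segVal_eq him] at this
  exact greenD_of_monD this
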